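/- Let A be an abelian category over ℂ with finite-dimensional Hom and Ext¹ spaces, and let 0 → Fⁿ → E → Gᵐ → 0 be a short exact sequence with F, G simple objects (Hom(F,F) = Hom(G,G) = ℂ), Hom(E, F) = 0, Hom(G, F) = 0, Hom(F, G) = 0, and Ext²(X,Y) = 0 for X,Y ∈ {F,G} whenever needed for the long exact sequence estimates. Then dim Ext¹(E,E) ≤ n²·dim Ext¹(F,F) + m²·dim Ext¹(G,G) + nm·dim Ext¹(F,G) + nm·dim Ext¹(G,F) − n². -/

import Mathlib

open CategoryTheory CategoryTheory.Limits Opposite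

attribute [local instance] CategoryTheory.Abelian.hasFiniteBiproducts

universe u v w

/-- `extMk` in degree one as a linear map on cocycles. -/
noncomputable def extMkLin {A : Type u} [Category.{v} A] [Abelian A] [Linear ℂ A]
    [HasExt.{w} A] {X : A} (P : ProjectiveResolution X) (Y : A) :
    LinearMap.ker (Linear.leftComp ℂ Y (P.complex.d 2 1)) →ₗ[ℂ] Abelian.Ext X Y 1 where
  toFun f := P.extMk f.1 2 rfl (show P.complex.d 2 1 ≫ f.1 = 0 from LinearMap.mem_ker.1 f.2)
  map_add' f g := (P.add_extMk f.1 g.1 2 rfl (show P.complex.d 2 1 ≫ f.1 = 0 from LinearMap.mem_ker.1 f.2) (show P.complex.d 2 1 ≫ g.1 = 0 from LinearMap.mem_ker.1 g.2)).symm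
  map_smul' r f := by
    rw [RingHom.id_apply, Abelian.Ext.smul_eq_comp_mk₀, ProjectiveResolution.extMk_comp_mk₀]
    congr 1
    simp

theorem extMkLin_surj {A : Type u} [Category.{v} A] [Abelian A] [Linear ℂ A]
    [HasExt.{w} A] {X : A} (P : ProjectiveResolution X) (Y : A) :
    Function.Surjective (extMkLin P Y) := by
  intro α
  obtain ⟨f, hf, h⟩ := P.extMk_surjective α 2 rfl
  exact ⟨⟨f, by simpa using hf⟩, h⟩

theorem extBridge {A : Type u} [Category.{v} A] [Abelian A] [Linear ℂ A] [EnoughProjectives A]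
    [HasExt.{w} A] (X Y : A) :
    Nonempty ((((Ext ℂ A 1).obj (op X)).obj Y) ≃ₗ[ℂ] Abelian.Ext X Y 1) := by
  let P := ProjectiveResolution.of X
  let K := P.complex.linearYonedaObj ℂ Y
  let e := P.isoExt (R := ℂ) 1 Y ≪≫
    ShortComplex.homologyMapIso (K.isoSc' 0 1 2 (by simp) (by simp)) ≪≫
    (K.sc' 0 1 2).moduleCatHomologyIso
  let S := K.sc' 0 1 2
  let φ : LinearMap.ker S.g.hom →ₗ[ℂ] Abelian.Ext X Y 1 := extMkLin P Y
  have hφ : Function.Surjective φ := extMkLin_surj P Y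
  have hk : LinearMap.range S.moduleCatToCycles = LinearMap.ker φ := by
    ext z
    refine Iff.trans ?_ (P.extMk_eq_zero_iff z.1 2 rfl z.2 0 rfl).symm
    constructor
    · rintro ⟨x, rfl⟩
      exact ⟨x, rfl⟩
    · rintro ⟨g, hg⟩
      exact ⟨g, Subtype.ext hg⟩
  let e2 : (LinearMap.ker S.g.hom ⧸ LinearMap.range S.moduleCatToCycles) ≃ₗ[ℂ]
      Abelian.Ext X Y 1 :=
    Submodule.quotEquivOfEq _ _ hk ≪≫ₗ φ.quotKerEquivOfSurjective hφ
  exact ⟨e.toLinearEquiv.trans e2⟩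

theorem linAux {D V W U : Type*} [AddCommGroup D] [AddCommGroup V] [AddCommGroup W]
    [AddCommGroup U] [Module ℂ D] [Module ℂ V] [Module ℂ W] [Module ℂ U]
    [FiniteDimensional ℂ V] [FiniteDimensional ℂ W] [FiniteDimensional ℂ U]
    (i : D →ₗ[ℂ] V) (a : V →ₗ[ℂ] W) (b : W →ₗ[ℂ] U)
    (hi : ∀ x, i x = 0 → x = 0) (hai : ∀ x, a (i x) = 0) (hab : ∀ y, b y = 0 → ∃ x, a x = y) :
    Module.finrank ℂ W + Module.finrank ℂ D ≤ Module.finrank ℂ V + Module.finrank ℂ U := by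
  have h1 := a.finrank_range_add_finrank_ker
  have h2 := b.finrank_range_add_finrank_ker
  have h3 := (LinearMap.range b).finrank_le
  have h4 : Module.finrank ℂ (LinearMap.ker b) ≤ Module.finrank ℂ (LinearMap.range a) :=
    Submodule.finrank_mono fun y hy => hab y hy
  have h5 : Module.finrank ℂ D ≤ Module.finrank ℂ (LinearMap.ker a) := by
    refine LinearMap.finrank_le_finrank_of_injective (f := i.codRestrict _ hai) ?_
    refine (injective_iff_map_eq_zero _).2 fun x hx => hi x ?_
    exact congrArg Subtype.val hx
  omega

theorem linAux' {V W U : Type*} [AddCommGroup V] [AddCommGroup W]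
    [AddCommGroup U] [Module ℂ V] [Module ℂ W] [Module ℂ U]
    [FiniteDimensional ℂ V] [FiniteDimensional ℂ W] [FiniteDimensional ℂ U]
    (a : V →ₗ[ℂ] W) (b : W →ₗ[ℂ] U) (hab : ∀ y, b y = 0 → ∃ x, a x = y) :
    Module.finrank ℂ W ≤ Module.finrank ℂ V + Module.finrank ℂ U := by
  have := linAux (D := PUnit.{1}) 0 a b (fun _ _ => rfl) (by simp) hab
  omega

theorem finrank_ext_biprod_left {A : Type u} [Category.{v} A] [Abelian A] [Linear ℂ A]
    [HasExt.{w} A] (X Y : A) (n k : ℕ) [FiniteDimensional ℂ (Abelian.Ext X Y k)] :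
    Module.finrank ℂ (Abelian.Ext (⨁ fun _ : Fin n => X) Y k) =
      n * Module.finrank ℂ (Abelian.Ext X Y k) := by
  let e : Abelian.Ext (⨁ fun _ : Fin n => X) Y k ≃ₗ[ℂ] (Fin n → Abelian.Ext X Y k) :=
    { Abelian.Ext.biproductAddEquiv (biproduct.isBilimit (fun _ : Fin n => X)) Y k with
      map_smul' := fun r x => by
        funext i
        exact Abelian.Ext.comp_smul _ _ (zero_add k) _ }
  rw [e.finrank_eq, Module.finrank_pi_fintype]
  simp

theorem finrank_ext_biprod_right {A : Type u} [Category.{v} A] [Abelian A] [Linear ℂ A]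
    [HasExt.{w} A] (X Y : A) (n k : ℕ) [FiniteDimensional ℂ (Abelian.Ext X Y k)] :
    Module.finrank ℂ (Abelian.Ext X (⨁ fun _ : Fin n => Y) k) =
      n * Module.finrank ℂ (Abelian.Ext X Y k) := by
  let e : Abelian.Ext X (⨁ fun _ : Fin n => Y) k ≃ₗ[ℂ] (Fin n → Abelian.Ext X Y k) :=
    { Abelian.Ext.addEquivBiproduct X (biproduct.isBilimit (fun _ : Fin n => Y)) k with
      map_smul' := fun r x => by
        funext i
        exact Abelian.Ext.smul_comp _ _ (add_zero k) _ }
  rw [e.finrank_eq, Module.finrank_pi_fintype]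
  simp


/-- Lemma 4.4: let `A` be a `ℂ`-linear abelian category with finite-dimensional Hom and
Ext¹ spaces, and let `0 → Fⁿ → E → Gᵐ → 0` be a short exact sequence with `F`, `G` simple
(`Hom(F,F) = Hom(G,G) = ℂ`), `Hom(E,F) = 0`, `Hom(G,F) = 0`, `Hom(F,G) = 0`, and with the
relevant `Ext²` groups between `F` and `G` vanishing.  Then
`ext¹(E,E) ≤ n² ext¹(F,F) + m² ext¹(G,G) + nm ext¹(F,G) + nm ext¹(G,F) − n²`. -/
theorem stmt12 (A : Type*) [Category A] [Abelian A] [Linear ℂ A] [EnoughProjectives A]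
    (hfinHom : ∀ X Y : A, FiniteDimensional ℂ (X ⟶ Y))
    (hfinExt : ∀ X Y : A, FiniteDimensional ℂ (((Ext ℂ A 1).obj (op X)).obj Y))
    (F G E : A) (n m : ℕ)
    (f : (⨁ fun _ : Fin n => F) ⟶ E) (g : E ⟶ (⨁ fun _ : Fin m => G))
    (w : f ≫ g = 0) (hse : (ShortComplex.mk f g w).ShortExact)
    (hFF : Module.finrank ℂ (F ⟶ F) = 1) (hGG : Module.finrank ℂ (G ⟶ G) = 1)
    (hEF : ∀ φ : E ⟶ F, φ = 0) (hGF : ∀ φ : G ⟶ F, φ = 0)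
    (hFG : ∀ φ : F ⟶ G, φ = 0)
    (hExt2 : ∀ X Y : A, (X = F ∨ X = G) → (Y = F ∨ Y = G) →
      Subsingleton (((Ext ℂ A 2).obj (op X)).obj Y)) :
    Module.finrank ℂ (((Ext ℂ A 1).obj (op E)).obj E)
      ≤ n ^ 2 * Module.finrank ℂ (((Ext ℂ A 1).obj (op F)).obj F)
        + m ^ 2 * Module.finrank ℂ (((Ext ℂ A 1).obj (op G)).obj G)
        + n * m * Module.finrank ℂ (((Ext ℂ A 1).obj (op F)).obj G)
        + n * m * Module.finrank ℂ (((Ext ℂ A 1).obj (op G)).obj F)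
        - n ^ 2 := by
  have : HasExt A := HasExt.standard A
  have hfd : ∀ X Y : A, FiniteDimensional ℂ (Abelian.Ext X Y 1) := fun X Y => by
    have := hfinExt X Y
    exact (extBridge X Y).some.finiteDimensional
  have hfd0 : ∀ X Y : A, FiniteDimensional ℂ (Abelian.Ext X Y 0) := fun X Y => by
    have := hfinHom X Y
    exact (Abelian.Ext.linearEquiv₀ (R := ℂ) (X := X) (Y := Y)).symm.finiteDimensional
  have hfr : ∀ X Y : A, Module.finrank ℂ (((Ext ℂ A 1).obj (op X)).obj Y) =
      Module.finrank ℂ (Abelian.Ext X Y 1) := fun X Y => (extBridge X Y).some.finrank_eq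
  simp only [hfr]
  have hF0 : Module.finrank ℂ (Abelian.Ext F F 0) = 1 := by
    rw [← hFF]
    exact (Abelian.Ext.linearEquiv₀ (R := ℂ)).finrank_eq
  -- the bound for `Ext¹(E,F)`
  have h1 := linAux (hse.extClass.precompOfLinear ℂ F (a := 0) (b := 1) rfl)
    ((Abelian.Ext.mk₀ g).precompOfLinear ℂ F (a := 1) (b := 1) rfl)
    ((Abelian.Ext.mk₀ f).precompOfLinear ℂ F (a := 1) (b := 1) rfl)
    (fun x hx => by
      obtain ⟨y, hy⟩ := Abelian.Ext.contravariant_sequence_exact₁ hse F x rfl hx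
      obtain ⟨φ, rfl⟩ := Abelian.Ext.mk₀_bijective _ _ |>.2 y
      rw [← hy, hEF φ, Abelian.Ext.mk₀_zero, Abelian.Ext.comp_zero])
    (fun x => hse.comp_extClass_assoc x rfl)
    (fun y hy => Abelian.Ext.contravariant_sequence_exact₂ hse F y hy)
  have h2 := linAux'
    ((Abelian.Ext.mk₀ g).precompOfLinear ℂ G (a := 1) (b := 1) rfl)
    ((Abelian.Ext.mk₀ f).precompOfLinear ℂ G (a := 1) (b := 1) rfl)
    (fun y hy => Abelian.Ext.contravariant_sequence_exact₂ hse G y hy)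
  have h3 := linAux'
    ((Abelian.Ext.mk₀ f).postcompOfLinear ℂ E (a := 1) (b := 1) rfl)
    ((Abelian.Ext.mk₀ g).postcompOfLinear ℂ E (a := 1) (b := 1) rfl)
    (fun y hy => Abelian.Ext.covariant_sequence_exact₂ E hse y hy)
  dsimp only at h1 h2 h3
  simp only [finrank_ext_biprod_left, finrank_ext_biprod_right, hF0] at h1 h2 h3
  apply Nat.le_sub_of_add_le
  nlinarith [Nat.mul_le_mul_left n h1, Nat.mul_le_mul_left m h2]
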